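/- Let k ≥ 4 be even, δ > 0, and 0 < ε < (k-1)!/k^k. For every sufficiently large constant c = c(k, δ, ε) there exists a constant C = C(c) > log(k) such that for all n, for every prime q, the probability that for H ~ H_k(n, cn) the kernel over ℤ/qℤ of M(H)^T contains an ε-balanced vector whose support has size at least δn is at most e^{-Cn}. -/

import Mathlib

open Finset Filter
open scoped Classical

/-- The set of all possible hyperedges: `k`-element subsets of `{1,...,n}` (as `Fin n`). -/
def edgeSet (n k : ℕ) : Finset (Finset (Fin n)) := Finset.powersetCard k Finset.univ

/-- The signed incidence matrix of a hypergraph `H` on `Fin n`: rows are vertices, columns are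
hyperedges; for `e = {v₁ < v₂ < ⋯ < v_k}` the entry at `(vᵢ, e)` is `(-1)^(i+1)`. -/
def signedInc {n : ℕ} (H : Finset (Finset (Fin n))) : Matrix (Fin n) {e // e ∈ H} ℤ :=
  fun u e => if u ∈ e.1 then (-1 : ℤ) ^ (e.1.filter (fun x => x < u)).card else 0

/-- Probability that `H ~ H_k(n,p)` (each of the `C(n,k)` possible hyperedges included
independently with probability `p`) satisfies the predicate `P`. -/
noncomputable def erProb (n k : ℕ) (p : ℝ) (P : Finset (Finset (Fin n)) → Prop) : ℝ :=
  ∑ H ∈ (edgeSet n k).powerset.filter (fun H => P H),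
    p ^ H.card * (1 - p) ^ ((edgeSet n k).card - H.card)

/-- The cokernel `ℤⁿ / Im M(H)` of the signed incidence matrix. -/
noncomputable abbrev Coker {n : ℕ} (H : Finset (Finset (Fin n))) :=
  (Fin n → ℤ) ⧸ LinearMap.range (Matrix.mulVecLin (signedInc H))

/-- Probability that `H ~ H_k(n,m)` (uniform on `k`-uniform hypergraphs on `{1,...,n}` with
exactly `m` hyperedges) satisfies the predicate `P`. -/
noncomputable def uniProb (n k m : ℕ) (P : Finset (Finset (Fin n)) → Prop) : ℝ :=
  ((((edgeSet n k).powersetCard m).filter (fun H => P H)).card : ℝ) /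
    (((edgeSet n k).powersetCard m).card : ℝ)

/-- A vector `v ∈ (ℤ/qℤ)ⁿ` is `ε`-balanced if every nonzero element of `ℤ/qℤ` appears at most
`ε·|supp(v)|` times among the entries of `v`. -/
def EpsBalanced {n q : ℕ} (ε : ℝ) (v : Fin n → ZMod q) : Prop :=
  ∀ x : ZMod q, x ≠ 0 →
    ((Finset.univ.filter (fun i => v i = x)).card : ℝ) ≤
      ε * ((Finset.univ.filter (fun i => v i ≠ 0)).card : ℝ)

section EdgeVectors

variable {n : ℕ}

/-- The signed indicator vector of the hyperedge `e` over a ring `R`. -/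
def edgeVec (R : Type*) [Ring R] (e : Finset (Fin n)) : Fin n → R :=
  fun u => if u ∈ e then (-1) ^ (e.filter (fun x => x < u)).card else 0

variable {R : Type*} [Ring R]

lemma edgeVec_dotProduct (e : Finset (Fin n)) (v : Fin n → R) :
    edgeVec R e ⬝ᵥ v = ∑ u ∈ e, (-1) ^ (e.filter (fun x => x < u)).card * v u := by
  simp [dotProduct, edgeVec, ite_mul, Finset.sum_ite_mem]

lemma mulVec_signedInc_eq_zero_iff {q : ℕ} (H : Finset (Finset (Fin n))) (v : Fin n → ZMod q) :
    Matrix.mulVec (((signedInc H).transpose).map (Int.cast : ℤ → ZMod q)) v = 0 ↔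
      ∀ e ∈ H, edgeVec (ZMod q) e ⬝ᵥ v = 0 := by
  have key : ∀ e : {e // e ∈ H},
      Matrix.mulVec (((signedInc H).transpose).map (Int.cast : ℤ → ZMod q)) v e =
        edgeVec (ZMod q) e.1 ⬝ᵥ v := by
    intro e
    simp only [Matrix.mulVec, dotProduct]
    refine Finset.sum_congr rfl fun u _ => ?_
    congr 1
    simp only [Matrix.map_apply, Matrix.transpose_apply, signedInc, edgeVec]
    split_ifs <;> simp
  constructor
  · intro h e he
    rw [← key ⟨e, he⟩, h]; rfl
  · intro h
    funext e
    rw [key e]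
    exact h e.1 e.2

/-- Deleting either one of two consecutive elements of `T` gives edges whose values differ by the
difference of `v` at these elements, up to sign. -/
lemma eq_of_consecutive {T : Finset (Fin n)} {v : Fin n → R} {a b : Fin n}
    (ha : a ∈ T) (hb : b ∈ T) (hab : a < b) (hcons : ∀ x ∈ T, ¬ (a < x ∧ x < b))
    (h₁ : edgeVec R (T.erase a) ⬝ᵥ v = 0) (h₂ : edgeVec R (T.erase b) ⬝ᵥ v = 0) :
    v a = v b := by
  rw [edgeVec_dotProduct] at h₁ h₂
  rw [← Finset.add_sum_erase _ _ (Finset.mem_erase.2 ⟨hab.ne', hb⟩)] at h₁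
  rw [← Finset.add_sum_erase _ _ (Finset.mem_erase.2 ⟨hab.ne, ha⟩)] at h₂
  have hpos : (T.erase a).filter (fun x => x < b) = (T.erase b).filter (fun x => x < a) := by
    ext x
    have := hcons x
    simp only [Finset.mem_filter, Finset.mem_erase]
    grind
  have hrest : ∑ u ∈ (T.erase a).erase b,
        (-1 : R) ^ ((T.erase a).filter (fun x => x < u)).card * v u =
      ∑ u ∈ (T.erase b).erase a, (-1 : R) ^ ((T.erase b).filter (fun x => x < u)).card * v u := by
    rw [Finset.erase_right_comm]
    refine Finset.sum_congr rfl fun u hu => ?_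
    simp only [Finset.mem_erase] at hu
    have hu' := hcons u hu.2.2
    have hiff : a < u ↔ b < u := by grind
    congr 2
    have hins : ∀ c d, c ∈ T → d ∈ T → (c < u ↔ d < u) →
        ((T.erase c).filter (fun x => x < u)).card = ((T.filter (fun x => x < u)).card -
          if d < u then 1 else 0) := by
      intro c d hc hd hcd
      rw [Finset.filter_erase]
      split_ifs with h
      · exact Finset.card_erase_of_mem (Finset.mem_filter.2 ⟨hc, hcd.2 h⟩)
      · rw [Finset.erase_eq_of_notMem]
        · simp
        · simp [hcd, h]
    rw [hins a a ha ha Iff.rfl, hins b a hb ha hiff.symm]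
  rw [hrest, hpos] at h₁
  have h := h₁.trans h₂.symm
  have h' := add_right_cancel h
  have hunit : IsUnit ((-1 : R) ^ ((T.erase b).filter (fun x => x < a)).card) :=
    (isUnit_one.neg).pow _
  exact (hunit.mul_left_cancel h').symm

lemma exists_erase_ne_zero {T : Finset (Fin n)} {v : Fin n → R} {i j : Fin n}
    (hi : i ∈ T) (hj : j ∈ T) (hij : v i ≠ v j) :
    ∃ t ∈ T, edgeVec R (T.erase t) ⬝ᵥ v ≠ 0 := by
  by_contra! hzero
  have key : ∀ d : ℕ, ∀ a ∈ T, ∀ b ∈ T, a < b → b.val - a.val ≤ d → v a = v b := by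
    intro d
    induction d with
    | zero => intro a _ b _ hab hd; have : a.val < b.val := hab; omega
    | succ d ih =>
      intro a ha b hb hab hd
      by_cases hc : ∃ x ∈ T, a < x ∧ x < b
      · obtain ⟨x, hx, hax, hxb⟩ := hc
        have h₁ : a.val < x.val := hax
        have h₂ : x.val < b.val := hxb
        exact (ih a ha x hx hax (by omega)).trans (ih x hx b hb hxb (by omega))
      · push Not at hc
        exact eq_of_consecutive ha hb hab (fun x hx h => (hc x hx h.1).not_gt h.2)
          (hzero a ha) (hzero b hb)
  rcases lt_trichotomy i j with h | h | h
  · exact hij (key _ i hi j hj h le_rfl)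
  · exact hij (congrArg v h)
  · exact hij (key _ j hj i hi h le_rfl).symm

end EdgeVectors

section Counting

variable {α : Type*} [DecidableEq α]

lemma choose_le_card_supersets_pair [Fintype α] {i j : α} (hij : i ≠ j) (k : ℕ) :
    (Fintype.card α - 2).choose k ≤
      ((Finset.powersetCard (k + 2) (Finset.univ : Finset α)).filter
        (fun T => i ∈ T ∧ j ∈ T)).card := by
  have hcard : (({i, j} : Finset α)ᶜ).card = Fintype.card α - 2 := by
    rw [Finset.card_compl, Finset.card_pair hij]
  rw [← hcard, ← Finset.card_powersetCard]
  refine Finset.card_le_card_of_injOn (fun A => A ∪ {i, j}) ?_ ?_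
  · intro A hA
    have hA := Finset.mem_powersetCard.1 (Finset.mem_coe.1 hA)
    have hd : Disjoint A {i, j} := Finset.disjoint_left.2 fun x hx =>
      Finset.mem_compl.1 (hA.1 hx)
    have hc : (A ∪ {i, j}).card = k + 2 := by
      rw [Finset.card_union_of_disjoint hd, hA.2, Finset.card_pair hij]
    exact Finset.mem_coe.2 (Finset.mem_filter.2
      ⟨Finset.mem_powersetCard.2 ⟨Finset.subset_univ _, hc⟩, by simp, by simp⟩)
  · intro A hA B hB hAB
    have hA := Finset.mem_powersetCard.1 (Finset.mem_coe.1 hA)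
    have hB := Finset.mem_powersetCard.1 (Finset.mem_coe.1 hB)
    have hdA : Disjoint A {i, j} := Finset.disjoint_left.2 fun x hx =>
      Finset.mem_compl.1 (hA.1 hx)
    have hdB : Disjoint B {i, j} := Finset.disjoint_left.2 fun x hx =>
      Finset.mem_compl.1 (hB.1 hx)
    rw [← hdA.sup_sdiff_cancel_right, ← hdB.sup_sdiff_cancel_right]
    exact congrArg (· \ {i, j}) hAB

lemma card_supersets_succ_le [Fintype α] (s : Finset (Finset α)) {k : ℕ} (hs : ∀ T ∈ s, T.card = k + 1)
    {e : Finset α} (he : e.card = k) :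
    (s.filter (fun T => e ⊆ T)).card ≤ Fintype.card α - k := by
  have hcard : (eᶜ).card = Fintype.card α - k := by rw [Finset.card_compl, he]
  rw [← hcard]
  refine (Finset.card_le_card (t := (eᶜ).image (fun x => insert x e)) ?_).trans
    Finset.card_image_le
  intro T hT
  obtain ⟨hTs, heT⟩ := Finset.mem_filter.1 hT
  have h1 : (T \ e).card = 1 := by
    rw [Finset.card_sdiff_of_subset heT, hs T hTs, he]; omega
  obtain ⟨x, hx⟩ := Finset.card_eq_one.1 h1
  have hxm : x ∈ T \ e := hx ▸ Finset.mem_singleton_self x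
  refine Finset.mem_image.2 ⟨x, Finset.mem_compl.2 (Finset.mem_sdiff.1 hxm).2, ?_⟩
  rw [Finset.insert_eq, ← hx, Finset.sdiff_union_of_subset heT]

lemma card_between_le (S E : Finset α) (hSE : S ⊆ E) (m : ℕ) (s : Finset (Finset α))
    (hs : ∀ H ∈ s, S ⊆ H ∧ H ⊆ E ∧ H.card = m) :
    s.card ≤ (E.card - S.card).choose (m - S.card) := by
  rw [← Finset.card_sdiff_of_subset hSE, ← Finset.card_powersetCard]
  refine Finset.card_le_card_of_injOn (fun H => H \ S) ?_ ?_
  · intro H hH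
    obtain ⟨h₁, h₂, h₃⟩ := hs H hH
    exact Finset.mem_coe.2 (Finset.mem_powersetCard.2
      ⟨Finset.sdiff_subset_sdiff h₂ le_rfl, by rw [Finset.card_sdiff_of_subset h₁, h₃]⟩)
  · intro H hH H' hH' h
    rw [← Finset.sdiff_union_of_subset (hs H hH).1, ← Finset.sdiff_union_of_subset (hs H' hH').1]
    exact congrArg (· ∪ S) h

end Counting

lemma choose_le_pow_mul_choose {a b : ℕ} {θ : ℝ} (hθ0 : 0 ≤ θ) (hθ1 : θ ≤ 1)
    (hab : (a : ℝ) ≤ θ * b) (j : ℕ) : (a.choose j : ℝ) ≤ θ ^ j * b.choose j := by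
  induction j with
  | zero => simp
  | succ j ih =>
    rcases lt_or_ge a (j + 1) with h | h
    · rw [Nat.choose_eq_zero_of_lt h]; simp only [Nat.cast_zero]; positivity
    have hb : (a : ℝ) ≤ b := hab.trans (mul_le_of_le_one_left (Nat.cast_nonneg b) hθ1)
    have hb' : a ≤ b := by exact_mod_cast hb
    have e₁ : (a.choose (j + 1) : ℝ) * (j + 1) = a.choose j * (a - j) := by
      have := Nat.choose_succ_right_eq a j
      rw [← Nat.cast_sub (by omega)]; exact_mod_cast this
    have e₂ : (b.choose (j + 1) : ℝ) * (j + 1) = b.choose j * (b - j) := by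
      have := Nat.choose_succ_right_eq b j
      rw [← Nat.cast_sub (by omega)]; exact_mod_cast this
    have hj : (0 : ℝ) < j + 1 := by positivity
    have hja : (j : ℝ) ≤ a := by exact_mod_cast (by omega : j ≤ a)
    have hlin : (a : ℝ) - j ≤ θ * (b - j) := by
      nlinarith [mul_le_of_le_one_left (Nat.cast_nonneg (α := ℝ) j) hθ1]
    refine le_of_mul_le_mul_right ?_ hj
    calc (a.choose (j + 1) : ℝ) * (j + 1) = a.choose j * (a - j) := e₁
      _ ≤ (θ ^ j * b.choose j) * (θ * (b - j)) :=
        mul_le_mul ih hlin (by linarith) (by positivity)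
      _ = θ ^ (j + 1) * (b.choose j * (b - j)) := by ring
      _ = θ ^ (j + 1) * b.choose (j + 1) * (j + 1) := by rw [← e₂]; ring

lemma sum_choose_le (c n : ℕ) (hc : 1 ≤ c) :
    ∑ r ∈ Finset.range (n + 1), ((c * n).choose r : ℝ) ≤ (c * Real.exp 1) ^ n := by
  have hc0 : (1 : ℝ) ≤ c := by exact_mod_cast hc
  have hcpos : (0 : ℝ) < c := by linarith
  have hsub : Finset.range (n + 1) ⊆ Finset.range (c * n + 1) :=
    Finset.range_subset_range.2 (by nlinarith)
  calc ∑ r ∈ Finset.range (n + 1), ((c * n).choose r : ℝ)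
      ≤ ∑ r ∈ Finset.range (n + 1), (c : ℝ) ^ n * ((1 / c) ^ r * (c * n).choose r) := by
        refine Finset.sum_le_sum fun r hr => ?_
        have hr : r ≤ n := Nat.lt_succ_iff.1 (Finset.mem_range.1 hr)
        rw [← mul_assoc]
        refine le_mul_of_one_le_left (Nat.cast_nonneg _) ?_
        rw [one_div, inv_pow, ← div_eq_mul_inv, one_le_div (by positivity)]
        exact pow_le_pow_right₀ hc0 hr
    _ ≤ ∑ r ∈ Finset.range (c * n + 1), (c : ℝ) ^ n * ((1 / c) ^ r * (c * n).choose r) :=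
        Finset.sum_le_sum_of_subset_of_nonneg hsub fun _ _ _ => by positivity
    _ = (c : ℝ) ^ n * (1 / c + 1) ^ (c * n) := by
        rw [← Finset.mul_sum, add_pow]; simp
    _ ≤ (c : ℝ) ^ n * (Real.exp (1 / c)) ^ (c * n) := by
        gcongr; exact Real.add_one_le_exp _
    _ = (c * Real.exp 1) ^ n := by
        rw [mul_pow, ← Real.exp_nat_mul, ← Real.exp_nat_mul]
        congr 2
        push_cast
        field_simp

section NonzeroEdges

variable {n : ℕ} {R : Type*} [Ring R]

lemma card_sigma_ne_mul_choose_le (l : ℕ) (v : Fin n → R) :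
    ((Finset.univ.filter (fun i => v i ≠ 0)).sigma
        (fun i => Finset.univ.filter (fun j => v i ≠ v j))).card * (n - 2).choose l ≤
      ((edgeSet n (l + 1)).filter (fun e => edgeVec R e ⬝ᵥ v ≠ 0)).card * (n - (l + 1)) *
        ((l + 2) * (l + 1)) := by
  set P := (Finset.univ.filter (fun i => v i ≠ 0)).sigma
    (fun i => Finset.univ.filter (fun j => v i ≠ v j)) with hP
  set G := (edgeSet n (l + 1)).filter (fun e => edgeVec R e ⬝ᵥ v ≠ 0) with hG
  set D := (Finset.powersetCard (l + 2) (Finset.univ : Finset (Fin n))).filter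
    (fun T => ∃ i ∈ T, ∃ j ∈ T, v i ≠ v j) with hD
  have hDcard : ∀ T ∈ D, T.card = l + 2 := fun T hT =>
    (Finset.mem_powersetCard.1 (Finset.mem_filter.1 hT).1).2
  have h₁ : P.card * (n - 2).choose l ≤ D.card * ((l + 2) * (l + 1)) := by
    refine Finset.card_mul_le_card_mul (fun p T => p.1 ∈ T ∧ p.2 ∈ T) ?_ ?_
    · rintro ⟨i, j⟩ hp
      have hv : v i ≠ v j := by
        simpa using (Finset.mem_sigma.1 hp).2
      have hij : i ≠ j := fun h => hv (congrArg v h)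
      have hle := choose_le_card_supersets_pair hij l
      rw [Fintype.card_fin] at hle
      refine hle.trans (Finset.card_le_card fun T hT => ?_)
      obtain ⟨hT₁, hi, hj⟩ := Finset.mem_filter.1 hT
      exact Finset.mem_filter.2 ⟨Finset.mem_filter.2 ⟨hT₁, i, hi, j, hj, hv⟩, hi, hj⟩
    · intro T hT
      have hoff : T.offDiag.card = (l + 2) * (l + 1) := by
        rw [Finset.offDiag_card, hDcard T hT]
        exact Nat.sub_eq_of_eq_add (by ring)
      rw [← hoff]
      refine Finset.card_le_card_of_injOn (fun p => (p.1, p.2)) ?_ ?_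
      · rintro ⟨i, j⟩ hp
        obtain ⟨hp, hi, hj⟩ := Finset.mem_filter.1 (Finset.mem_coe.1 hp)
        have hv : v i ≠ v j := by simpa using (Finset.mem_sigma.1 hp).2
        exact Finset.mem_coe.2 (Finset.mem_offDiag.2 ⟨hi, hj, fun h => hv (congrArg v h)⟩)
      · rintro ⟨i, j⟩ _ ⟨i', j'⟩ _ h
        simp only [Prod.mk.injEq] at h
        obtain ⟨rfl, rfl⟩ := h
        rfl
  have h₂ : D.card * 1 ≤ G.card * (n - (l + 1)) := by
    refine Finset.card_mul_le_card_mul (fun T e => e ⊆ T) ?_ ?_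
    · intro T hT
      obtain ⟨-, i, hi, j, hj, hv⟩ := Finset.mem_filter.1 hT
      obtain ⟨t, ht, hne⟩ := exists_erase_ne_zero hi hj hv
      refine Finset.card_pos.2 ⟨T.erase t, Finset.mem_filter.2
        ⟨Finset.mem_filter.2 ⟨Finset.mem_powersetCard.2 ⟨Finset.subset_univ _, ?_⟩, hne⟩,
          Finset.erase_subset _ _⟩⟩
      rw [Finset.card_erase_of_mem ht, hDcard T hT]; rfl
    · intro e he
      have hle := card_supersets_succ_le D hDcard
        (Finset.mem_powersetCard.1 (Finset.mem_filter.1 he).1).2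
      rwa [Fintype.card_fin] at hle
  calc P.card * (n - 2).choose l ≤ D.card * 1 * ((l + 2) * (l + 1)) := by rwa [mul_one]
    _ ≤ _ := Nat.mul_le_mul_right _ h₂

lemma card_zero_edges_le {q k : ℕ} (hk : 2 ≤ k) (hkn : k < n) {δ ε : ℝ}
    (hδ : 0 < δ) (hε : ε < 1) {v : Fin n → ZMod q} (hbal : EpsBalanced ε v)
    (hsupp : δ * n ≤ ((Finset.univ.filter (fun i => v i ≠ 0)).card : ℝ)) :
    (((edgeSet n k).filter (fun e => edgeVec (ZMod q) e ⬝ᵥ v = 0)).card : ℝ) ≤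
      (1 - δ * (1 - ε) / (k + 1)) * (edgeSet n k).card := by
  obtain ⟨l, rfl⟩ : ∃ l, k = l + 1 := ⟨k - 1, by omega⟩
  obtain ⟨a, rfl⟩ : ∃ a, n = a + 2 := ⟨n - 2, by omega⟩
  have hpairs := card_sigma_ne_mul_choose_le l v
  set G := (edgeSet (a + 2) (l + 1)).filter (fun e => edgeVec (ZMod q) e ⬝ᵥ v ≠ 0) with hG
  set Z := (edgeSet (a + 2) (l + 1)).filter (fun e => edgeVec (ZMod q) e ⬝ᵥ v = 0) with hZ
  have hsplit : Z.card + G.card = (edgeSet (a + 2) (l + 1)).card :=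
    Finset.card_filter_add_card_filter_not _
  have hN : (edgeSet (a + 2) (l + 1)).card = (a + 2).choose (l + 1) := by
    simp [edgeSet]
  set s := Finset.univ.filter (fun i => v i ≠ 0) with hs
  have hsn : (s.card : ℝ) ≤ (a + 2 : ℕ) := by
    have := Finset.card_le_univ s
    rw [Fintype.card_fin] at this
    exact_mod_cast this
  have hfiber : ∀ i ∈ s, (1 - ε) * (a + 2 : ℕ) ≤
      ((Finset.univ.filter (fun j => v i ≠ v j)).card : ℝ) := by
    intro i hi
    have hb := hbal (v i) (by simpa [hs] using hi)
    have hc : (Finset.univ.filter (fun j => v j = v i)).card +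
        (Finset.univ.filter (fun j => v i ≠ v j)).card = a + 2 := by
      have := Finset.card_filter_add_card_filter_not (s := (Finset.univ : Finset (Fin (a + 2))))
        (fun j => v j = v i)
      rw [Finset.card_univ, Fintype.card_fin] at this
      simpa only [ne_eq, eq_comm] using this
    have hc' : ((Finset.univ.filter (fun j => v j = v i)).card : ℝ) +
        (Finset.univ.filter (fun j => v i ≠ v j)).card = (a + 2 : ℕ) := by exact_mod_cast hc
    have hε' : ε * s.card ≤ ε * (a + 2 : ℕ) := by
      rcases le_or_gt 0 ε with h | h
      · gcongr
      · have h0 : (0 : ℝ) ≤ (Finset.univ.filter (fun j => v j = v i)).card := Nat.cast_nonneg _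
        have hpos : (0 : ℝ) < s.card := by exact_mod_cast Finset.card_pos.2 ⟨i, hi⟩
        nlinarith [hb]
    have hb' : ((Finset.univ.filter (fun j => v j = v i)).card : ℝ) ≤ ε * s.card := by
      convert hb using 3
    linarith
  have hP : δ * (1 - ε) * (a + 2 : ℕ) * (a + 2 : ℕ) ≤
      ((s.sigma (fun i => Finset.univ.filter (fun j => v i ≠ v j))).card : ℝ) := by
    rw [Finset.card_sigma]
    calc δ * (1 - ε) * (a + 2 : ℕ) * (a + 2 : ℕ)
        = (δ * (a + 2 : ℕ)) * ((1 - ε) * (a + 2 : ℕ)) := by ring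
      _ ≤ s.card * ((1 - ε) * (a + 2 : ℕ)) :=
        mul_le_mul_of_nonneg_right hsupp (mul_nonneg (by linarith) (Nat.cast_nonneg _))
      _ = ∑ i ∈ s, (1 - ε) * (a + 2 : ℕ) := by rw [Finset.sum_const, nsmul_eq_mul]
      _ ≤ _ := by
        rw [Nat.cast_sum]
        exact Finset.sum_le_sum hfiber
  have hchoose : (a + 2) * (a + 1) * a.choose l =
      (a + 2).choose (l + 1) * (l + 1) * (a + 2 - (l + 1)) := by
    have e₁ := Nat.choose_mul_succ_eq a l
    have e₂ := Nat.add_one_mul_choose_eq (a + 1) l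
    have e₃ : a + 2 - (l + 1) = a + 1 - l := by omega
    rw [e₃, ← e₂]
    calc (a + 2) * (a + 1) * a.choose l = (a + 2) * (a.choose l * (a + 1)) := by ring
      _ = _ := by rw [e₁]; ring
  set d := a + 2 - (l + 1) with hd
  have hdpos : (0 : ℝ) < d := by exact_mod_cast (by omega : 0 < d)
  have hchoose' : ((a : ℝ) + 2) * (a + 1) * a.choose l =
      (a + 2).choose (l + 1) * (l + 1) * d := by exact_mod_cast hchoose
  have hpairs' : ((s.sigma (fun i => Finset.univ.filter (fun j => v i ≠ v j))).card : ℝ) *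
      a.choose l ≤ G.card * d * ((l + 2) * (l + 1)) := by
    have h2 : a + 2 - 2 = a := by omega
    rw [h2] at hpairs
    exact_mod_cast hpairs
  have hδε : 0 ≤ δ * (1 - ε) := mul_nonneg hδ.le (by linarith)
  have hmain : δ * (1 - ε) * (a + 2).choose (l + 1) ≤ G.card * (l + 2) := by
    have hpos : (0 : ℝ) < (l + 1) * d := by positivity
    refine le_of_mul_le_mul_right ?_ hpos
    calc δ * (1 - ε) * (a + 2).choose (l + 1) * ((l + 1) * d)
        = δ * (1 - ε) * (((a : ℝ) + 2) * (a + 1) * a.choose l) := by rw [hchoose']; ring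
      _ ≤ δ * (1 - ε) * (((a : ℝ) + 2) * (a + 2) * a.choose l) := by gcongr; norm_num
      _ = δ * (1 - ε) * (a + 2 : ℕ) * (a + 2 : ℕ) * a.choose l := by push_cast; ring
      _ ≤ _ := mul_le_mul_of_nonneg_right hP (Nat.cast_nonneg _)
      _ ≤ G.card * d * ((l + 2) * (l + 1)) := hpairs'
      _ = G.card * (l + 2) * ((l + 1) * d) := by ring
  have hsplit' : (Z.card : ℝ) + G.card = (a + 2).choose (l + 1) := by
    rw [← hN]; exact_mod_cast hsplit
  have hl : (0 : ℝ) < l + 2 := by positivity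
  have hG' : δ * (1 - ε) / (l + 2) * (a + 2).choose (l + 1) ≤ G.card := by
    rw [div_mul_eq_mul_div, div_le_iff₀ hl]; exact hmain
  rw [hN]
  push_cast
  rw [show (l : ℝ) + 1 + 1 = l + 2 by ring]
  linarith

end NonzeroEdges

section UnionBound

variable {n k : ℕ} {K : Type*} [Field K]

lemma exists_spanning_subset (H : Finset (Finset (Fin n))) :
    ∃ S ⊆ H, S.card ≤ n ∧
      ∀ e ∈ H, edgeVec K e ∈ Submodule.span K (edgeVec K '' (S : Set (Finset (Fin n)))) := by
  obtain ⟨b, hbH, -, hspan, hli⟩ := exists_linearIndepOn_extension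
    (linearIndepOn_empty K (edgeVec K (n := n))) (Set.empty_subset (H : Set (Finset (Fin n))))
  refine ⟨b.toFinset, fun e he => by simpa using hbH (Set.mem_toFinset.1 he), ?_, ?_⟩
  · have h := LinearIndependent.fintype_card_le_finrank (R := K) hli
    rwa [Module.finrank_fin_fun, ← Set.toFinset_card] at h
  · intro e he
    rw [Set.coe_toFinset]
    exact hspan ⟨e, he, rfl⟩

lemma dotProduct_eq_zero_of_mem_span {s : Set (Fin n → K)} {v w : Fin n → K}
    (hs : ∀ x ∈ s, x ⬝ᵥ v = 0) (hw : w ∈ Submodule.span K s) : w ⬝ᵥ v = 0 := by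
  induction hw using Submodule.span_induction with
  | mem x hx => exact hs x hx
  | zero => exact zero_dotProduct v
  | add x y _ _ hx hy => rw [add_dotProduct, hx, hy, add_zero]
  | smul a x _ hx => rw [smul_dotProduct, hx, smul_zero]

/-- Union bound over a spanning set of hyperedges: once it is chosen, all other hyperedges lie in
its span, hence among the few edges that annihilate a vector of `V`. -/
lemma card_exists_annihilated_le [DecidableEq K] {m : ℕ} (V : Set (Fin n → K)) {θ : ℝ} (hθ0 : 0 ≤ θ)
    (hθ1 : θ ≤ 1)
    (hV : ∀ v ∈ V, (((edgeSet n k).filter (fun e => edgeVec K e ⬝ᵥ v = 0)).card : ℝ) ≤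
      θ * (edgeSet n k).card) :
    ((((edgeSet n k).powersetCard m).filter
        (fun H => ∃ v ∈ V, ∀ e ∈ H, edgeVec K e ⬝ᵥ v = 0)).card : ℝ) ≤
      ∑ r ∈ Finset.range (n + 1), ((edgeSet n k).card.choose r : ℝ) *
        (θ ^ (m - r) * ((edgeSet n k).card - r).choose (m - r)) := by
  set Ω := edgeSet n k with hΩ
  let closure : Finset (Finset (Fin n)) → Finset (Finset (Fin n)) := fun S =>
    Ω.filter (fun e => edgeVec K e ∈ Submodule.span K (edgeVec K '' (S : Set (Finset (Fin n)))))
  let seeds : ℕ → Finset (Finset (Finset (Fin n))) := fun r =>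
    (Ω.powersetCard r).filter (fun S => ∃ v ∈ V, ∀ e ∈ S, edgeVec K e ⬝ᵥ v = 0)
  let fib : Finset (Finset (Fin n)) → Finset (Finset (Finset (Fin n))) := fun S =>
    (Ω.powersetCard m).filter (fun H => S ⊆ H ∧ H ⊆ closure S)
  have hcover : (Ω.powersetCard m).filter
      (fun H => ∃ v ∈ V, ∀ e ∈ H, edgeVec K e ⬝ᵥ v = 0) ⊆
      (Finset.range (n + 1)).biUnion (fun r => (seeds r).biUnion fib) := by
    intro H hH
    obtain ⟨hHm, v, hv, hHv⟩ := Finset.mem_filter.1 hH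
    have hHΩ := (Finset.mem_powersetCard.1 hHm).1
    obtain ⟨S, hSH, hSn, hspan⟩ := exists_spanning_subset (K := K) H
    refine Finset.mem_biUnion.2 ⟨S.card, Finset.mem_range.2 (by omega),
      Finset.mem_biUnion.2 ⟨S, Finset.mem_filter.2 ⟨Finset.mem_powersetCard.2
        ⟨hSH.trans hHΩ, rfl⟩, v, hv, fun e he => hHv e (hSH he)⟩,
        Finset.mem_filter.2 ⟨hHm, hSH, fun e he =>
          Finset.mem_filter.2 ⟨hHΩ he, hspan e he⟩⟩⟩⟩
  have hfib : ∀ r, ∀ S ∈ seeds r,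
      ((fib S).card : ℝ) ≤ θ ^ (m - r) * (Ω.card - r).choose (m - r) := by
    intro r S hS
    obtain ⟨hSm, v, hv, hSv⟩ := Finset.mem_filter.1 hS
    obtain ⟨hSΩ, hSr⟩ := Finset.mem_powersetCard.1 hSm
    have hScl : S ⊆ closure S := fun e he =>
      Finset.mem_filter.2 ⟨hSΩ he, Submodule.subset_span ⟨e, he, rfl⟩⟩
    have hcl : ((closure S).card : ℝ) ≤ θ * Ω.card := by
      refine le_trans ?_ (hV v hv)
      refine Nat.cast_le.2 (Finset.card_le_card fun e he => ?_)
      obtain ⟨heΩ, he⟩ := Finset.mem_filter.1 he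
      refine Finset.mem_filter.2 ⟨heΩ, dotProduct_eq_zero_of_mem_span ?_ he⟩
      rintro _ ⟨e', he', rfl⟩
      exact hSv e' he'
    have h₁ : (fib S).card ≤ ((closure S).card - r).choose (m - r) := by
      rw [← hSr]
      refine card_between_le S (closure S) hScl m _ fun H hH => ?_
      obtain ⟨hHm, hSH, hHS⟩ := Finset.mem_filter.1 hH
      exact ⟨hSH, hHS, (Finset.mem_powersetCard.1 hHm).2⟩
    have hrcl : r ≤ (closure S).card := hSr ▸ Finset.card_le_card hScl
    have hrΩ : r ≤ Ω.card := hSr ▸ Finset.card_le_card hSΩ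
    refine (Nat.cast_le.2 h₁).trans (choose_le_pow_mul_choose hθ0 hθ1 ?_ _)
    rw [Nat.cast_sub hrcl, Nat.cast_sub hrΩ]
    nlinarith [mul_le_of_le_one_left (Nat.cast_nonneg (α := ℝ) r) hθ1]
  calc _ ≤ (((Finset.range (n + 1)).biUnion (fun r => (seeds r).biUnion fib)).card : ℝ) :=
        Nat.cast_le.2 (Finset.card_le_card hcover)
    _ ≤ ∑ r ∈ Finset.range (n + 1), (((seeds r).biUnion fib).card : ℝ) := by
        exact_mod_cast Finset.card_biUnion_le
    _ ≤ _ := by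
        refine Finset.sum_le_sum fun r _ => ?_
        calc (((seeds r).biUnion fib).card : ℝ) ≤ ∑ S ∈ seeds r, ((fib S).card : ℝ) := by
              exact_mod_cast Finset.card_biUnion_le
          _ ≤ (seeds r).card * (θ ^ (m - r) * (Ω.card - r).choose (m - r)) := by
              rw [← nsmul_eq_mul]
              exact Finset.sum_le_card_nsmul _ _ _ (hfib r)
          _ ≤ _ := by
              refine mul_le_mul_of_nonneg_right ?_ (by positivity)
              rw [← Finset.card_powersetCard]
              exact Nat.cast_le.2 (Finset.card_filter_le _ _)

lemma uniProb_exists_annihilated_le [DecidableEq K] {c : ℕ} (hc : 1 ≤ c)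
    (V : Set (Fin n → K)) {θ : ℝ}
    (hθ0 : 0 ≤ θ) (hθ1 : θ ≤ 1)
    (hV : ∀ v ∈ V, (((edgeSet n k).filter (fun e => edgeVec K e ⬝ᵥ v = 0)).card : ℝ) ≤
      θ * (edgeSet n k).card) :
    uniProb n k (c * n) (fun H => ∃ v ∈ V, ∀ e ∈ H, edgeVec K e ⬝ᵥ v = 0) ≤
      (c * Real.exp 1 * θ ^ (c - 1)) ^ n := by
  have hbound := card_exists_annihilated_le (m := c * n) V hθ0 hθ1 hV
  set N := (edgeSet n k).card with hN
  have hn : n ≤ c * n := Nat.le_mul_of_pos_left n hc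
  have hterm : ∀ r ∈ Finset.range (n + 1),
      (N.choose r : ℝ) * (θ ^ (c * n - r) * (N - r).choose (c * n - r)) ≤
        N.choose (c * n) * (θ ^ ((c - 1) * n) * (c * n).choose r) := by
    intro r hr
    have hr : r ≤ n := Nat.lt_succ_iff.1 (Finset.mem_range.1 hr)
    have hmul : (N.choose (c * n) : ℝ) * (c * n).choose r =
        N.choose r * (N - r).choose (c * n - r) := by
      exact_mod_cast Nat.choose_mul (n := N) (hr.trans hn)
    have hpow : θ ^ (c * n - r) ≤ θ ^ ((c - 1) * n) := by
      refine pow_le_pow_of_le_one hθ0 hθ1 ?_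
      rw [Nat.sub_mul, one_mul]
      omega
    calc (N.choose r : ℝ) * (θ ^ (c * n - r) * (N - r).choose (c * n - r))
        = θ ^ (c * n - r) * (N.choose (c * n) * (c * n).choose r) := by rw [hmul]; ring
      _ ≤ θ ^ ((c - 1) * n) * (N.choose (c * n) * (c * n).choose r) :=
        mul_le_mul_of_nonneg_right hpow (by positivity)
      _ = _ := by ring
  have hsum := hbound.trans (Finset.sum_le_sum hterm)
  rw [← Finset.mul_sum, ← Finset.mul_sum] at hsum
  have hden : ((edgeSet n k).powersetCard (c * n)).card = N.choose (c * n) :=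
    Finset.card_powersetCard _ _
  rw [uniProb, hden]
  refine div_le_of_le_mul₀ (Nat.cast_nonneg _) (by positivity) (hsum.trans ?_)
  rw [mul_comm]
  refine mul_le_mul_of_nonneg_right ?_ (Nat.cast_nonneg _)
  calc θ ^ ((c - 1) * n) * ∑ r ∈ Finset.range (n + 1), ((c * n).choose r : ℝ)
      ≤ θ ^ ((c - 1) * n) * (c * Real.exp 1) ^ n :=
        mul_le_mul_of_nonneg_left (sum_choose_le c n hc) (by positivity)
    _ = _ := by rw [pow_mul, ← mul_pow, mul_comm]

end UnionBound

lemma uniProb_le_one (n k m : ℕ) (P : Finset (Finset (Fin n)) → Prop) :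
    uniProb n k m P ≤ 1 :=
  div_le_one_of_le₀ (Nat.cast_le.2 (Finset.card_filter_le _ _)) (Nat.cast_nonneg _)

lemma eventually_mul_pow_pred_le {θ η : ℝ} (hθ0 : 0 < θ) (hθ1 : θ < 1) (hη : 0 < η) :
    ∀ᶠ c : ℕ in atTop, c * Real.exp 1 * θ ^ (c - 1) ≤ η := by
  have hpos : 0 < η * θ / Real.exp 1 := by positivity
  filter_upwards [(tendsto_self_mul_const_pow_of_lt_one hθ0.le hθ1).eventually_lt_const hpos,
    eventually_ge_atTop 1] with c hc hc1
  obtain ⟨b, rfl⟩ : ∃ b, c = b + 1 := ⟨c - 1, by omega⟩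
  rw [lt_div_iff₀ (Real.exp_pos 1), pow_succ] at hc
  rw [Nat.add_sub_cancel]
  refine le_of_mul_le_mul_right ?_ hθ0
  linarith

/-- For `k ≥ 4` even, `δ > 0` and `0 < ε < (k-1)!/k^k`, for every
sufficiently large constant `c` there is `C > log k` such that for all `n` and every prime
`q`, the probability that `ker_{ℤ/qℤ}(M(H)ᵀ)` for `H ~ H_k(n, cn)` contains an `ε`-balanced
vector of support size at least `δn` is at most `e^{-Cn}`. -/
theorem large_support_kernel_even (k : ℕ) (hk : 4 ≤ k) (heven : Even k)
    (δ : ℝ) (hδ : 0 < δ) (ε : ℝ) (hε0 : 0 < ε)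
    (hε1 : ε < ((k - 1).factorial : ℝ) / (k : ℝ) ^ k) :
    ∃ c₀ : ℕ, ∀ c : ℕ, c₀ ≤ c → ∃ C : ℝ, Real.log k < C ∧
      ∀ n q : ℕ, q.Prime →
        uniProb n k (c * n) (fun H => ∃ v : Fin n → ZMod q,
            Matrix.mulVec (((signedInc H).transpose).map (Int.cast : ℤ → ZMod q)) v = 0 ∧
            EpsBalanced ε v ∧
            δ * n ≤ ((Finset.univ.filter (fun i => v i ≠ 0)).card : ℝ)) ≤
          Real.exp (-C * n) := by
  have hε : ε < 1 := by
    refine hε1.trans_le (div_le_one_of_le₀ ?_ (by positivity))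
    exact_mod_cast (Nat.factorial_le (Nat.sub_le k 1)).trans (Nat.factorial_le_pow k)
  set δ' := min δ 1 with hδ'
  have hδ'0 : 0 < δ' := lt_min hδ one_pos
  have hp0 : 0 < δ' * (1 - ε) / (k + 1) := by
    have : 0 < 1 - ε := by linarith
    positivity
  have hp1 : δ' * (1 - ε) / (k + 1) < 1 := by
    rw [div_lt_one (by positivity)]
    have hk0 : (4 : ℝ) ≤ k := by exact_mod_cast hk
    nlinarith [min_le_right δ 1]
  set θ := 1 - δ' * (1 - ε) / (k + 1) with hθ
  have hθ0 : 0 < θ := by linarith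
  have hθ1 : θ < 1 := by linarith
  obtain ⟨c₁, hc₁⟩ := eventually_atTop.1 (eventually_mul_pow_pred_le (θ := θ)
    hθ0 hθ1 (Real.exp_pos (-(Real.log k + 1))))
  refine ⟨max c₁ 1, fun c hc => ⟨Real.log k + 1, by linarith, fun n q hq => ?_⟩⟩
  have hc1 : 1 ≤ c := (le_max_right _ _).trans hc
  have hsmall := hc₁ c ((le_max_left _ _).trans hc)
  rcases Nat.eq_zero_or_pos n with rfl | hn
  · simpa using uniProb_le_one 0 k (c * 0) _
  rcases le_or_gt n k with hnk | hkn
  · have hN : (edgeSet n k).card < c * n := by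
      have h : (edgeSet n k).card = n.choose k := by simp [edgeSet]
      rw [h]
      rcases hnk.lt_or_eq with h | rfl
      · rw [Nat.choose_eq_zero_of_lt h]; positivity
      · rw [Nat.choose_self]; nlinarith
    rw [uniProb, Finset.powersetCard_eq_empty.2 hN]
    simpa using (Real.exp_pos _).le
  have : Fact q.Prime := ⟨hq⟩
  let V : Set (Fin n → ZMod q) := {v | EpsBalanced ε v ∧
    δ * n ≤ ((Finset.univ.filter (fun i => v i ≠ 0)).card : ℝ)}
  have hV : ∀ v ∈ V, (((edgeSet n k).filter (fun e => edgeVec (ZMod q) e ⬝ᵥ v = 0)).card : ℝ) ≤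
      θ * (edgeSet n k).card := fun v hv =>
    card_zero_edges_le (by omega) hkn hδ'0 hε hv.1
      ((mul_le_mul_of_nonneg_right (min_le_left δ 1) (Nat.cast_nonneg n)).trans hv.2)
  have hevent : (fun H : Finset (Finset (Fin n)) => ∃ v : Fin n → ZMod q,
      Matrix.mulVec (((signedInc H).transpose).map (Int.cast : ℤ → ZMod q)) v = 0 ∧
      EpsBalanced ε v ∧ δ * n ≤ ((Finset.univ.filter (fun i => v i ≠ 0)).card : ℝ)) =
      fun H => ∃ v ∈ V, ∀ e ∈ H, edgeVec (ZMod q) e ⬝ᵥ v = 0 := by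
    funext H
    refine propext (exists_congr fun v => ?_)
    rw [mulVec_signedInc_eq_zero_iff, and_comm]
    rfl
  rw [hevent, mul_comm _ (n : ℝ), Real.exp_nat_mul]
  refine (uniProb_exists_annihilated_le hc1 V hθ0.le hθ1.le hV).trans ?_
  exact pow_le_pow_left₀ (by positivity) hsmall n
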